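/- The sum over all partitions λ of n of s_λ evaluated at the specialization x_i = t^{i-1} (i ≥ 1), summed as a generating function ∑_{λ} s_λ(1, t, t², ...)·u^{|λ|}, equals ∏_{i≥1} (1 − u·t^{i−1})^{−1} · ∏_{1≤i<j} (1 − u²·t^{i+j−2})^{−1} as formal power series in u and t. -/

import Mathlib

/-- The Schur polynomial associated to a partition given as a list `l = (λ_1, λ_2, ...)` of
parts, defined by the Jacobi–Trudi formula `s_λ = det(h_{λ_i − i + j})` in terms of the
complete homogeneous symmetric polynomials `h_m` (with `h_m = 0` for `m < 0`). -/
noncomputable def schurJT (σ : Type*) (R : Type*) [Fintype σ] [DecidableEq σ] [CommRing R]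
    (l : List ℕ) : MvPolynomial σ R :=
  Matrix.det (Matrix.of fun i j : Fin l.length =>
    if ((l.get i : ℤ) + (j : ℤ) - (i : ℤ)) < 0 then 0
    else MvPolynomial.hsymm σ R ((l.get i : ℤ) + (j : ℤ) - (i : ℤ)).toNat)

/-- The parts of a partition of `k`, listed in weakly decreasing order. -/
def sortedParts {k : ℕ} (p : Nat.Partition k) : List ℕ :=
  (p.parts.sort (· ≤ ·)).reverse

open Finset

theorem Matrix.det_sum_mul_rows {A : Type*} [CommRing A] {m : ℕ} (S : Fin m → Finset ℕ)
    (w : Fin m → ℕ → A) (r : Fin m → ℕ → Fin m → A) :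
    Matrix.det (Matrix.of fun i j => ∑ k ∈ S i, w i k * r i k j) =
      ∑ l ∈ Fintype.piFinset S, (∏ i, w i (l i)) * Matrix.det (Matrix.of fun i => r i (l i)) := by
  have h := (Matrix.detRowAlternating (n := Fin m) (R := A)).toMultilinearMap.map_sum_finset
    (fun i k => w i k • r i k) S
  simp only [AlternatingMap.coe_multilinearMap, MultilinearMap.map_smul_univ] at h
  refine Eq.trans ?_ h
  change Matrix.det _ = Matrix.det _
  congr 1
  ext i j
  simp

theorem Matrix.det_eq_of_forall_row_eq_smul_add_succ {A : Type*} [CommRing A] {m : ℕ}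
    {P Q : Matrix (Fin (m + 1)) (Fin (m + 1)) A} (c : Fin m → A)
    (h_last : ∀ j, P (Fin.last m) j = Q (Fin.last m) j)
    (h_castSucc : ∀ (i : Fin m) (j), P i.castSucc j = Q i.castSucc j + c i * P i.succ j) :
    P.det = Q.det := by
  rw [← Matrix.det_submatrix_equiv_self Fin.revPerm P,
    ← Matrix.det_submatrix_equiv_self Fin.revPerm Q]
  refine Matrix.det_eq_of_forall_row_eq_smul_add_pred (fun i => c i.rev) (fun j => ?_)
    fun i j => ?_
  · simp [h_last]
  · simp [Fin.rev_succ, Fin.rev_castSucc, h_castSucc]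

theorem Matrix.det_of_last_row_eq_zero {A : Type*} [CommRing A] {m : ℕ}
    (P : Matrix (Fin (m + 1)) (Fin (m + 1)) A) (h : ∀ j : Fin m, P (Fin.last m) j.castSucc = 0) :
    P.det = P (Fin.last m) (Fin.last m) * (P.submatrix Fin.castSucc Fin.castSucc).det := by
  rw [Matrix.det_succ_row P (Fin.last m), Fin.sum_univ_castSucc]
  simp only [h, mul_zero, zero_mul, sum_const_zero, zero_add, Fin.val_last,
    Even.neg_one_pow ⟨m, rfl⟩, one_mul]
  congr 2
  ext i j
  simp

/-- The Jacobi–Trudi determinant `det (h (l i + j - i))` of a sequence `h`. -/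
def jacobiTrudi {A : Type*} [CommRing A] {m : ℕ} (h : ℤ → A) (l : Fin m → ℕ) : A :=
  Matrix.det (Matrix.of fun i j : Fin m => h (l i + j - i))

theorem map_jacobiTrudi {A B : Type*} [CommRing A] [CommRing B] (f : A →+* B) {m : ℕ} (h : ℤ → A)
    (l : Fin m → ℕ) : f (jacobiTrudi h l) = jacobiTrudi (f ∘ h) l := by
  rw [jacobiTrudi, RingHom.map_det]
  rfl

theorem jacobiTrudi_of_last_eq_zero {A : Type*} [CommRing A] {h : ℤ → A}
    (h_neg : ∀ k < 0, h k = 0) (h_zero : h 0 = 1) {m : ℕ} {l : Fin (m + 1) → ℕ}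
    (hl : l (Fin.last m) = 0) :
    jacobiTrudi h l = jacobiTrudi h fun i : Fin m => l i.castSucc := by
  rw [jacobiTrudi, Matrix.det_of_last_row_eq_zero]
  · simp only [Matrix.of_apply, hl]
    simp only [Fin.val_last, Nat.cast_zero, zero_add, sub_self, h_zero, one_mul]
    rfl
  · intro j
    apply h_neg
    have := j.2
    simp only [hl, Fin.val_last, Fin.val_castSucc]
    lia

theorem jacobiTrudi_pow_mul {A : Type*} [CommRing A] {h g : ℤ → A} (u : A)
    (g_neg : ∀ k < 0, g k = 0) (hg : ∀ k, h k = u ^ k.toNat * g k) {m : ℕ} (l : Fin m → ℕ) :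
    jacobiTrudi h l = u ^ (∑ i, l i) * jacobiTrudi g l := by
  simp only [jacobiTrudi, Matrix.det_apply', mul_sum, Matrix.of_apply]
  refine sum_congr rfl fun s _ => ?_
  rw [mul_left_comm]
  congr 1
  by_cases hs : ∃ i, (l (s i) + i - s i : ℤ) < 0
  · obtain ⟨i, hi⟩ := hs
    rw [prod_eq_zero (mem_univ i), prod_eq_zero (mem_univ i), mul_zero]
    · exact g_neg _ hi
    · rw [hg, g_neg _ hi, mul_zero]
  · push Not at hs
    simp only [hg, prod_mul_distrib]
    rw [prod_pow_eq_pow_sum]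
    congr 2
    zify
    rw [sum_congr rfl fun i _ => Int.toNat_of_nonneg (hs i), sum_sub_distrib, sum_add_distrib,
      Equiv.sum_comp s fun i => (l i : ℤ), Equiv.sum_comp s fun i : Fin m => ((i : ℕ) : ℤ)]
    ring

/-- The sequences `k` such that `l / k` is a horizontal strip. -/
def interlacingBelow {m : ℕ} (l : Fin (m + 1) → ℕ) : Finset (Fin (m + 1) → ℕ) :=
  Fintype.piFinset fun i =>
    Icc (Fin.snoc (α := fun _ => ℕ) (fun i : Fin m => l i.succ) 0 i) (l i)

/-- The sequences `k` with entries at most `M` such that `k / l` is a horizontal strip. -/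
def interlacingAbove {m : ℕ} (M : ℕ) (l : Fin (m + 1) → ℕ) : Finset (Fin (m + 1) → ℕ) :=
  Fintype.piFinset fun i =>
    Icc (l i) (Fin.cons (α := fun _ => ℕ) M (fun i : Fin m => l i.castSucc) i)

theorem mem_interlacingBelow {m : ℕ} {l k : Fin (m + 1) → ℕ} :
    k ∈ interlacingBelow l ↔ (∀ i, k i ≤ l i) ∧ ∀ i : Fin m, l i.succ ≤ k i.castSucc := by
  simp only [interlacingBelow, Fintype.mem_piFinset, mem_Icc, forall_and]
  rw [and_comm]
  refine and_congr_right fun _ => ?_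
  rw [Fin.forall_fin_succ']
  simp

theorem mem_interlacingAbove {m M : ℕ} {l k : Fin (m + 1) → ℕ} :
    k ∈ interlacingAbove M l ↔
      (∀ i, l i ≤ k i) ∧ k 0 ≤ M ∧ ∀ i : Fin m, k i.succ ≤ l i.castSucc := by
  simp only [interlacingAbove, Fintype.mem_piFinset, mem_Icc, forall_and]
  refine and_congr_right fun _ => ?_
  rw [Fin.forall_fin_succ]
  simp

theorem eq_sum_Icc_add_of_eq_add_mul_pred {A : Type*} [CommRing A] {h h' : ℤ → A} {y : A}
    (hh : ∀ k, h' k = h k + y * h' (k - 1)) (z : ℤ) {p q : ℕ} (hpq : p ≤ q) :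
    h' (q + z) = ∑ k ∈ Icc p q, y ^ (q - k) * h (k + z) + y ^ (q - p + 1) * h' (p - 1 + z) := by
  induction q, hpq using Nat.le_induction with
  | base => simp [hh (p + z), show (p : ℤ) + z - 1 = p - 1 + z by ring]
  | succ q hpq ih =>
    rw [sum_Icc_succ_top (by lia), hh, show ((q + 1 : ℕ) : ℤ) + z - 1 = q + z by push_cast; ring,
      ih, mul_add, mul_sum, Nat.sub_self, pow_zero, one_mul, Nat.sub_add_comm hpq]
    rw [sum_congr rfl fun k hk => show y * (y ^ (q - k) * h (k + z)) =
      y ^ (q + 1 - k) * h (k + z) by rw [Nat.sub_add_comm (mem_Icc.1 hk).2]; ring]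
    ring

theorem eq_sum_Icc_add_of_eq_add_mul_succ {A : Type*} [CommRing A] {h T : ℤ → A} {y : A}
    (hT : ∀ k, T k = h k + y * T (k + 1)) (z : ℤ) {p q : ℕ} (hpq : p ≤ q) :
    T (p + z) = ∑ k ∈ Icc p q, y ^ (k - p) * h (k + z) + y ^ (q - p + 1) * T (q + 1 + z) := by
  induction q, hpq using Nat.le_induction with
  | base => simp [hT (p + z), show (p : ℤ) + z + 1 = p + 1 + z by ring]
  | succ q hpq ih =>
    rw [sum_Icc_succ_top (by lia), ih, show (q : ℤ) + 1 + z = (q + 1 : ℕ) + z by push_cast; ring,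
      hT, Nat.sub_add_comm hpq, show ((q + 1 : ℕ) : ℤ) + z + 1 = (q + 1 : ℕ) + 1 + z by ring]
    ring

theorem jacobiTrudi_branching {A : Type*} [CommRing A] {h h' : ℤ → A} {y : A}
    (hh : ∀ k, h' k = h k + y * h' (k - 1)) (h'_neg : ∀ k < 0, h' k = 0) {m : ℕ}
    {l : Fin (m + 1) → ℕ} (hl : Antitone l) :
    jacobiTrudi h' l =
      ∑ k ∈ interlacingBelow l, (∏ i, y ^ (l i - k i)) * jacobiTrudi h k := by
  refine Eq.trans ?_ (Matrix.det_sum_mul_rows _ (fun i k => y ^ (l i - k))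
    fun i k j => h (k + j - i))
  refine Matrix.det_eq_of_forall_row_eq_smul_add_succ
    (fun i => y ^ (l i.castSucc - l i.succ + 1)) (fun j => ?_) fun i j => ?_
  · simp only [Matrix.of_apply, Fin.snoc_last, add_sub_assoc]
    rw [eq_sum_Icc_add_of_eq_add_mul_pred hh _ (Nat.zero_le _), h'_neg (_ - 1 + _), mul_zero,
      add_zero]
    have := j.2
    rw [Fin.val_last]
    lia
  · simp only [Matrix.of_apply, Fin.snoc_castSucc, add_sub_assoc]
    rw [eq_sum_Icc_add_of_eq_add_mul_pred hh _ (hl (Fin.castSucc_lt_succ (i := i)).le)]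
    congr 3
    simp only [Fin.val_castSucc, Fin.val_succ]
    push_cast
    ring

theorem jacobiTrudi_pieri {A : Type*} [CommRing A] {h T : ℤ → A} {y : A} {M : ℕ}
    (h_neg : ∀ k < 0, h k = 0) (h_zero : h 0 = 1)
    (hT : ∀ k, T k = h k + y * T (k + 1)) (hT_top : ∀ k > (M : ℤ), T k = 0) {m : ℕ}
    {l : Fin (m + 1) → ℕ} (hl : Antitone l) (hlM : l 0 ≤ M) (hl0 : l (Fin.last m) = 0) :
    ∑ k ∈ interlacingAbove M l, (∏ i, y ^ (k i - l i)) * jacobiTrudi h k =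
      T 0 * jacobiTrudi h l := by
  have rows : ∑ k ∈ interlacingAbove M l, (∏ i, y ^ (k i - l i)) * jacobiTrudi h k =
      jacobiTrudi T l := by
    refine Eq.symm (Eq.trans ?_ (Matrix.det_sum_mul_rows _ (fun i k => y ^ (k - l i))
      fun i k j => h (k + j - i)))
    refine Matrix.det_eq_of_forall_row_eq_smul_add_pred
      (fun i => y ^ (l i.castSucc - l i.succ + 1)) (fun j => ?_) fun i j => ?_
    · simp only [Matrix.of_apply, Fin.cons_zero, add_sub_assoc]
      rw [eq_sum_Icc_add_of_eq_add_mul_succ hT _ hlM, hT_top (_ + 1 + _), mul_zero, add_zero]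
      rw [Fin.val_zero]
      lia
    · simp only [Matrix.of_apply, Fin.cons_succ, add_sub_assoc]
      rw [eq_sum_Icc_add_of_eq_add_mul_succ hT _ (hl (Fin.castSucc_lt_succ (i := i)).le)]
      congr 3
      simp only [Fin.val_castSucc, Fin.val_succ]
      push_cast
      ring
  let Q : Matrix (Fin (m + 1)) (Fin (m + 1)) A := Matrix.of fun i j =>
    Fin.snoc (α := fun _ => A) (fun j : Fin m => h (l i + j - i)) (T (l i + m - i)) j
  have cols : jacobiTrudi T l = Q.det := by
    rw [jacobiTrudi, ← Matrix.det_transpose, ← Matrix.det_transpose Q]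
    refine Matrix.det_eq_of_forall_row_eq_smul_add_succ (fun _ => y) (fun j => ?_) fun i j => ?_
    · simp [Q]
    · simp only [Matrix.transpose_apply, Matrix.of_apply, Q, Fin.snoc_castSucc, Fin.val_succ,
        Fin.val_castSucc]
      rw [hT]
      congr 3
      push_cast
      ring
  rw [rows, cols, Matrix.det_of_last_row_eq_zero, jacobiTrudi_of_last_eq_zero h_neg h_zero hl0]
  · congr 1
    · simp [Q, hl0]
    · rw [jacobiTrudi]
      congr 1
      ext i j
      simp [Q]
  · intro j
    have := j.2
    simp only [Q, Matrix.of_apply, Fin.snoc_castSucc, hl0, Fin.val_last]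
    exact h_neg _ (by lia)

/-- The complete homogeneous symmetric polynomial of degree `k` evaluated at the first `n` terms
of a sequence `x`, with value `0` for negative `k`. -/
noncomputable def completeHomog {A : Type*} [CommRing A] (x : ℕ → A) (n : ℕ) (k : ℤ) : A :=
  if k < 0 then 0
  else MvPolynomial.aeval (fun i : Fin n => x i) (MvPolynomial.hsymm (Fin n) ℤ k.toNat)

theorem completeHomog_of_neg {A : Type*} [CommRing A] (x : ℕ → A) (n : ℕ) {k : ℤ} (hk : k < 0) :
    completeHomog x n k = 0 :=
  if_pos hk

theorem completeHomog_natCast {A : Type*} [CommRing A] (x : ℕ → A) (n k : ℕ) :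
    completeHomog x n k = ∑ s : Sym (Fin n) k, (s.1.map fun i => x i).prod := by
  rw [completeHomog, if_neg (by lia), Int.toNat_natCast, MvPolynomial.hsymm, map_sum]
  refine sum_congr rfl fun s _ => ?_
  rw [map_multiset_prod, Multiset.map_map]
  simp [Function.comp_def]

theorem completeHomog_zero {A : Type*} [CommRing A] (x : ℕ → A) (n : ℕ) :
    completeHomog x n 0 = 1 := by
  simp [completeHomog]

theorem completeHomog_no_variables {A : Type*} [CommRing A] (x : ℕ → A) {k : ℤ} (hk : k ≠ 0) :
    completeHomog x 0 k = 0 := by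
  rcases lt_or_ge k 0 with h | h
  · exact completeHomog_of_neg x 0 h
  · lift k to ℕ using h
    obtain ⟨k, rfl⟩ := Nat.exists_eq_succ_of_ne_zero (Nat.cast_ne_zero.1 hk)
    rw [completeHomog_natCast]
    simp

theorem map_completeHomog {A B : Type*} [CommRing A] [CommRing B] (f : A →+* B) (x : ℕ → A)
    (n : ℕ) (k : ℤ) : f (completeHomog x n k) = completeHomog (f ∘ x) n k := by
  rcases lt_or_ge k 0 with h | h
  · simp [completeHomog_of_neg _ n h]
  · lift k to ℕ using h
    simp [completeHomog_natCast, map_multiset_prod, Multiset.map_map, Function.comp_def]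

theorem completeHomog_mul_left {A : Type*} [CommRing A] (u : A) (x : ℕ → A) (n : ℕ) (k : ℤ) :
    completeHomog (fun i => u * x i) n k = u ^ k.toNat * completeHomog x n k := by
  rcases lt_or_ge k 0 with h | h
  · simp [completeHomog_of_neg _ n h]
  · lift k to ℕ using h
    simp [completeHomog_natCast, Multiset.prod_map_mul, mul_sum]

theorem MvPolynomial.hsymm_option_succ (σ R : Type*) [Fintype σ] [DecidableEq σ] [CommRing R]
    (k : ℕ) :
    hsymm (Option σ) R (k + 1) =
      rename some (hsymm σ R (k + 1)) + X none * hsymm (Option σ) R k := by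
  rw [hsymm, ← Equiv.sum_comp (symOptionSuccEquiv (α := σ) (n := k)).symm, Fintype.sum_sum_type,
    add_comm]
  congr 1
  · rw [hsymm, map_sum]
    refine sum_congr rfl fun s _ => ?_
    rw [map_multiset_prod]
    simp [symOptionSuccEquiv, Multiset.map_map]
  · rw [hsymm, mul_sum]
    refine sum_congr rfl fun s _ => ?_
    change ((none ::ₘ s.1).map X).prod = _
    rw [Multiset.map_cons, Multiset.prod_cons]

theorem completeHomog_succ {A : Type*} [CommRing A] (x : ℕ → A) (n : ℕ) (k : ℤ) :
    completeHomog x (n + 1) k =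
      completeHomog x n k + x n * completeHomog x (n + 1) (k - 1) := by
  rcases lt_trichotomy k 0 with h | rfl | h
  · simp [completeHomog_of_neg x _ h, completeHomog_of_neg x _ (show k - 1 < 0 by lia)]
  · simp [completeHomog_zero, completeHomog_of_neg]
  · obtain ⟨k, rfl⟩ : ∃ r : ℕ, k = (r + 1 : ℕ) := ⟨(k - 1).toNat, by lia⟩
    have key (r : ℕ) : completeHomog x (n + 1) r =
        MvPolynomial.aeval (fun o : Option (Fin n) => o.elim (x n) fun i => x i)
          (MvPolynomial.hsymm (Option (Fin n)) ℤ r) := by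
      rw [completeHomog, if_neg (by lia), Int.toNat_natCast,
        ← MvPolynomial.rename_hsymm _ _ _ finSuccEquivLast, MvPolynomial.aeval_rename]
      congr 2
      ext i
      refine Fin.lastCases ?_ (fun i => ?_) i <;> simp
    rw [show ((k + 1 : ℕ) : ℤ) - 1 = k by push_cast; ring, key, key,
      MvPolynomial.hsymm_option_succ, map_add, map_mul, MvPolynomial.aeval_rename,
      MvPolynomial.aeval_X, completeHomog, if_neg (by lia)]
    rfl

/-- The truncated generating function `∑_{r ≤ M} y ^ r * h (k + r)`. -/
def truncatedTail {A : Type*} [CommRing A] (M : ℕ) (h : ℤ → A) (y : A) (k : ℤ) : A :=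
  ∑ r ∈ range (M + 1), y ^ r * h (k + r)

theorem truncatedTail_eq_add_mul {A : Type*} [CommRing A] {M : ℕ} (h : ℤ → A) {y : A}
    (hy : y ^ (M + 1) = 0) (k : ℤ) :
    truncatedTail M h y k = h k + y * truncatedTail M h y (k + 1) := by
  rw [truncatedTail, sum_range_succ', truncatedTail, sum_range_succ, mul_add, ← mul_assoc,
    ← pow_succ', hy, mul_sum, add_comm]
  simp only [pow_succ', mul_assoc, Nat.cast_add, Nat.cast_one, Nat.cast_zero, add_zero, pow_zero,
    one_mul, zero_mul]
  simp only [← add_assoc, add_right_comm k]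

theorem truncatedTail_completeHomog_mul_prod {A : Type*} [CommRing A] {M : ℕ} (x : ℕ → A) {y : A}
    (hy : y ^ (M + 1) = 0) (n : ℕ) :
    truncatedTail M (completeHomog x n) y 0 * ∏ i ∈ range n, (1 - x i * y) = 1 := by
  induction n with
  | zero =>
    rw [truncatedTail, sum_range_succ']
    simp only [zero_add, Nat.cast_zero, completeHomog_zero, range_zero, prod_empty, pow_zero,
      mul_one]
    rw [sum_eq_zero fun r _ => ?_, zero_add]
    rw [completeHomog_no_variables x (by lia), mul_zero]
  | succ n ih =>
    have h_shift : truncatedTail M (completeHomog x (n + 1)) y 0 =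
        truncatedTail M (completeHomog x n) y 0 +
          x n * truncatedTail M (completeHomog x (n + 1)) y (-1) := by
      rw [truncatedTail, truncatedTail, truncatedTail, mul_sum, ← sum_add_distrib]
      refine sum_congr rfl fun r _ => ?_
      rw [completeHomog_succ, show (0 : ℤ) + r - 1 = -1 + r by ring]
      ring
    rw [truncatedTail_eq_add_mul _ hy (-1), completeHomog_of_neg _ _ (by lia), zero_add,
      neg_add_cancel] at h_shift
    rw [prod_range_succ]
    linear_combination ih + (∏ i ∈ range n, (1 - x i * y)) * h_shift

open scoped Classical in
/-- The partitions with at most `m + 1` parts, all of size at most `M`. -/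
noncomputable def partitionBox (m M : ℕ) : Finset (Fin (m + 1) → ℕ) :=
  {l ∈ Fintype.piFinset fun _ => range (M + 1) | Antitone l}

theorem mem_partitionBox {m M : ℕ} {l : Fin (m + 1) → ℕ} :
    l ∈ partitionBox m M ↔ (∀ i, l i ≤ M) ∧ Antitone l := by
  simp [partitionBox]

theorem mem_partitionBox_and_mem_interlacingBelow {m M : ℕ} {l k : Fin (m + 1) → ℕ} :
    l ∈ partitionBox m M ∧ k ∈ interlacingBelow l ↔
      l ∈ interlacingAbove M k ∧ k ∈ partitionBox m M := by
  simp only [mem_partitionBox, mem_interlacingBelow, mem_interlacingAbove, Fin.antitone_iff_succ_le]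
  constructor
  · rintro ⟨⟨hM, -⟩, hle, hs⟩
    exact ⟨⟨hle, hM 0, hs⟩, fun i => (hle i).trans (hM i), fun i => (hle _).trans (hs i)⟩
  · rintro ⟨⟨hle, h0, hs⟩, hM, -⟩
    refine ⟨⟨fun i => ?_, fun i => (hs i).trans (hle _)⟩, hle, hs⟩
    refine Fin.cases h0 (fun i => (hs i).trans (hM _)) i

theorem sum_Icc_pow_sub_reflect {A : Type*} [CommRing A] (y : A) (p q : ℕ) :
    ∑ k ∈ Icc p q, y ^ (k - p) = ∑ k ∈ Icc p q, y ^ (q - k) := by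
  refine sum_nbij' (fun k => p + q - k) (fun k => p + q - k) ?_ ?_ ?_ ?_ ?_ <;>
    simp only [mem_Icc] <;> intro k hk
  · lia
  · lia
  · lia
  · lia
  · congr 1
    lia

theorem one_sub_mul_sum_Icc_pow_sub {A : Type*} [CommRing A] (y : A) {p q : ℕ} (hpq : p ≤ q) :
    (1 - y) * ∑ k ∈ Icc p q, y ^ (k - p) = 1 - y ^ (q - p + 1) := by
  induction q, hpq using Nat.le_induction with
  | base => simp
  | succ q hpq ih =>
    rw [sum_Icc_succ_top (by lia), mul_add, ih, Nat.sub_add_comm hpq]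
    ring

theorem one_sub_mul_sum_interlacingAbove {A : Type*} [CommRing A] (y : A) {m M : ℕ}
    {l : Fin (m + 1) → ℕ} (hlM : l 0 ≤ M) (hl0 : l (Fin.last m) = 0) :
    (1 - y) * ∑ k ∈ interlacingAbove M l, ∏ i, y ^ (k i - l i) =
      (1 - y ^ (M - l 0 + 1)) * ∑ k ∈ interlacingBelow l, ∏ i, y ^ (l i - k i) := by
  rw [interlacingAbove, interlacingBelow,
    ← prod_univ_sum _ (fun i k => y ^ (k - l i)), ← prod_univ_sum _ (fun i k => y ^ (l i - k)),
    Fin.prod_univ_succ, Fin.prod_univ_castSucc]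
  simp only [Fin.cons_zero, Fin.cons_succ, Fin.snoc_castSucc, Fin.snoc_last, hl0, Icc_self,
    sum_singleton, Nat.sub_self, pow_zero, mul_one, sum_Icc_pow_sub_reflect y (l (Fin.succ _))]
  rw [← mul_assoc, one_sub_mul_sum_Icc_pow_sub y hlM]

theorem one_sub_mul_sum_jacobiTrudi {A : Type*} [CommRing A] {h h' T : ℤ → A} {y : A} {M : ℕ}
    (h_neg : ∀ k < 0, h k = 0) (h_zero : h 0 = 1)
    (hh : ∀ k, h' k = h k + y * h' (k - 1)) (h'_neg : ∀ k < 0, h' k = 0)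
    (hT : ∀ k, T k = h k + y * T (k + 1)) (hT_top : ∀ k > (M : ℤ), T k = 0)
    (h_nil : ∀ (l : Fin (M + 1) → ℕ) (e : ℕ), M < e + ∑ i, l i → y ^ e * jacobiTrudi h l = 0) :
    (1 - y) * ∑ l ∈ partitionBox M M, jacobiTrudi h' l =
      T 0 * ∑ l ∈ partitionBox M M, jacobiTrudi h l := by
  have h_last {l : Fin (M + 1) → ℕ} (hl : Antitone l) (hl0 : l (Fin.last M) ≠ 0) :
      jacobiTrudi h l = 0 := by
    have hsum : ∑ _i : Fin (M + 1), 1 ≤ ∑ i, l i :=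
      sum_le_sum fun i _ => (Nat.one_le_iff_ne_zero.2 hl0).trans (hl (Fin.le_last i))
    simpa using h_nil l 0 (by simpa using hsum)
  calc (1 - y) * ∑ l ∈ partitionBox M M, jacobiTrudi h' l
      = (1 - y) * ∑ l ∈ partitionBox M M, ∑ k ∈ interlacingBelow l,
          (∏ i, y ^ (l i - k i)) * jacobiTrudi h k := by
        congr 1
        exact sum_congr rfl fun l hl =>
          jacobiTrudi_branching hh h'_neg (mem_partitionBox.1 hl).2
    _ = ∑ k ∈ partitionBox M M,
          ((1 - y) * ∑ l ∈ interlacingAbove M k, ∏ i, y ^ (l i - k i)) * jacobiTrudi h k := by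
        rw [sum_comm' fun _ _ => mem_partitionBox_and_mem_interlacingBelow, mul_sum]
        simp only [sum_mul, mul_sum, mul_assoc]
    _ = ∑ k ∈ partitionBox M M, ∑ l ∈ interlacingBelow k,
          (∏ i, y ^ (k i - l i)) * jacobiTrudi h k := by
        refine sum_congr rfl fun k hk => ?_
        obtain ⟨hkM, hk⟩ := mem_partitionBox.1 hk
        by_cases hk0 : k (Fin.last M) = 0
        · have h0 := h_nil k (M - k 0 + 1) (by
            have := single_le_sum (fun i _ => Nat.zero_le (k i)) (mem_univ 0)
            have := hkM 0
            lia)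
          rw [one_sub_mul_sum_interlacingAbove y (hkM 0) hk0, ← sum_mul]
          linear_combination (-∑ l ∈ interlacingBelow k, ∏ i, y ^ (k i - l i)) * h0
        · simp [h_last hk hk0]
    _ = ∑ l ∈ partitionBox M M, ∑ k ∈ interlacingAbove M l,
          (∏ i, y ^ (k i - l i)) * jacobiTrudi h k :=
        sum_comm' fun _ _ => mem_partitionBox_and_mem_interlacingBelow
    _ = T 0 * ∑ l ∈ partitionBox M M, jacobiTrudi h l := by
        rw [mul_sum]
        refine sum_congr rfl fun l hl => ?_
        by_cases hl0 : l (Fin.last M) = 0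
        · obtain ⟨hlM, hl⟩ := mem_partitionBox.1 hl
          exact jacobiTrudi_pieri h_neg h_zero hT hT_top hl (hlM 0) hl0
        · rw [h_last (mem_partitionBox.1 hl).2 hl0, mul_zero]
          refine sum_eq_zero fun k hk => ?_
          have hbox := mem_partitionBox_and_mem_interlacingBelow.2 ⟨hk, hl⟩
          have hle := (mem_interlacingAbove.1 hk).1 (Fin.last M)
          rw [h_last (mem_partitionBox.1 hbox.1).2 (by lia), mul_zero]

theorem sum_jacobiTrudi_completeHomog_no_variables {A : Type*} [CommRing A] (x : ℕ → A)
    (m M : ℕ) : ∑ l ∈ partitionBox m M, jacobiTrudi (completeHomog x 0) l = 1 := by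
  rw [sum_eq_single 0]
  · rw [jacobiTrudi, ← Matrix.det_one (n := Fin (m + 1))]
    congr 1
    ext i j
    rw [Matrix.of_apply, Matrix.one_apply]
    split_ifs with hij
    · simp [hij, completeHomog_zero]
    · refine completeHomog_no_variables x ?_
      have := Fin.val_ne_of_ne hij
      simp only [Pi.zero_apply, Nat.cast_zero]
      lia
  · intro l hl hne
    refine Matrix.det_eq_zero_of_row_eq_zero 0 fun j => ?_
    rw [Matrix.of_apply]
    refine completeHomog_no_variables x ?_
    have : l 0 ≠ 0 := fun h0 =>
      hne (funext fun i => Nat.le_zero.1 (h0 ▸ (mem_partitionBox.1 hl).2 (Fin.zero_le i)))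
    rw [Fin.val_zero]
    lia
  · exact fun h => absurd (mem_partitionBox.2 ⟨fun _ => Nat.zero_le _, fun _ _ _ => le_rfl⟩) h

theorem prod_range_succ_pairs_lt {A : Type*} [CommMonoid A] (f : ℕ → ℕ → A) (n : ℕ) :
    ∏ p ∈ (range (n + 1) ×ˢ range (n + 1)).filter (fun p : ℕ × ℕ => p.1 < p.2), f p.1 p.2 =
      (∏ p ∈ (range n ×ˢ range n).filter (fun p : ℕ × ℕ => p.1 < p.2), f p.1 p.2) *
        ∏ i ∈ range n, f i n := by
  simp only [prod_filter, prod_product, prod_range_succ, prod_mul_distrib, lt_irrefl, if_false,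
    mul_one]
  rw [prod_congr (s₁ := range n) (f := fun i => if i < n then f i n else 1) rfl fun i hi =>
    if_pos (mem_range.1 hi), prod_eq_one (s := range n) (f := fun j => if n < j then f n j else 1)
    fun j hj => if_neg (mem_range.1 hj).not_gt, mul_one]

theorem littlewood_identity_of_nilpotent {A : Type*} [CommRing A] {M : ℕ} {u : A}
    (hu : u ^ (M + 1) = 0) (a : ℕ → A) (n : ℕ) :
    (∑ l ∈ partitionBox M M, jacobiTrudi (completeHomog (fun i => u * a i) n) l) *
        (∏ i ∈ range n, (1 - u * a i)) *
        (∏ p ∈ (range n ×ˢ range n).filter (fun p : ℕ × ℕ => p.1 < p.2),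
          (1 - u * a p.1 * (u * a p.2))) = 1 := by
  induction n with
  | zero => simp [sum_jacobiTrudi_completeHomog_no_variables]
  | succ n ih =>
    have hy : (u * a n) ^ (M + 1) = 0 := by rw [mul_pow, hu, zero_mul]
    have step := one_sub_mul_sum_jacobiTrudi (M := M)
      (fun k => completeHomog_of_neg (fun i => u * a i) n) (completeHomog_zero _ _)
      (completeHomog_succ _ n) (fun k => completeHomog_of_neg _ _)
      (truncatedTail_eq_add_mul _ hy)
      (fun k hk => sum_eq_zero fun r _ => by
        rw [completeHomog_mul_left, pow_eq_zero_of_le (by lia) hu, zero_mul, mul_zero])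
      (fun l e he => by
        rw [jacobiTrudi_pow_mul u (fun k => completeHomog_of_neg a n)
          (completeHomog_mul_left u a n), mul_pow, mul_mul_mul_comm, ← pow_add,
          pow_eq_zero_of_le (by lia) hu, zero_mul])
    have hH := truncatedTail_completeHomog_mul_prod (fun i => u * a i) hy n
    rw [prod_range_succ, prod_range_succ_pairs_lt fun i j => 1 - u * a i * (u * a j)]
    calc _ = ((1 - u * a n) * ∑ l ∈ partitionBox M M,
            jacobiTrudi (completeHomog (fun i => u * a i) (n + 1)) l) *
          (∏ i ∈ range n, (1 - u * a i)) *
          (∏ p ∈ (range n ×ˢ range n).filter (fun p : ℕ × ℕ => p.1 < p.2),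
            (1 - u * a p.1 * (u * a p.2))) * ∏ i ∈ range n, (1 - u * a i * (u * a n)) := by ring
      _ = _ := by
        rw [step]
        refine Eq.trans ?_ ((congrArg₂ (· * ·) hH ih).trans (one_mul 1))
        ring

theorem aeval_schurJT {A : Type*} [CommRing A] [inst : Algebra ℤ A] (x : ℕ → A) (n : ℕ)
    (l : List ℕ) :
    MvPolynomial.aeval (fun i : Fin n => x i) (schurJT (Fin n) ℤ l) =
      jacobiTrudi (completeHomog x n) l.get := by
  obtain rfl : inst = Ring.toIntAlgebra A := Subsingleton.elim _ _
  rw [schurJT, AlgHom.map_det, jacobiTrudi]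
  congr 1
  ext i j
  simp only [AlgHom.mapMatrix_apply, Matrix.map_apply, Matrix.of_apply, completeHomog]
  split_ifs <;> simp

theorem jacobiTrudi_getD {A : Type*} [CommRing A] {h : ℤ → A} (h_neg : ∀ k < 0, h k = 0)
    (h_zero : h 0 = 1) (l : List ℕ) {N : ℕ} (hN : l.length ≤ N) :
    jacobiTrudi h (fun i : Fin N => l.getD i 0) = jacobiTrudi h l.get := by
  induction N, hN using Nat.le_induction with
  | base =>
    congr 1
    ext i
    simp
  | succ N hN ih =>
    rw [jacobiTrudi_of_last_eq_zero h_neg h_zero (by simp [hN]), ← ih]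
    rfl

theorem List.ofFn_getD_zero (l : List ℕ) {N : ℕ} (hN : l.length ≤ N) :
    List.ofFn (fun i : Fin N => l.getD i 0) = l ++ List.replicate (N - l.length) 0 := by
  refine List.ext_getElem (by simp [hN]) fun i h₁ h₂ => ?_
  rw [List.getElem_ofFn, List.getElem_append]
  split_ifs with hi
  · simp [hi]
  · simp [not_lt.1 hi]

theorem antitone_iff_pairwise_ofFn {N : ℕ} {f : Fin N → ℕ} :
    Antitone f ↔ (List.ofFn f).Pairwise (· ≥ ·) := by
  rw [List.pairwise_ofFn]
  exact ⟨fun hf i j hij => hf hij.le, fun hf i j hij =>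
    hij.eq_or_lt.elim (fun h => h ▸ le_rfl) fun h => hf h⟩

theorem coe_sortedParts {k : ℕ} (p : Nat.Partition k) : (sortedParts p : Multiset ℕ) = p.parts := by
  rw [sortedParts, Multiset.coe_reverse, Multiset.sort_eq]

theorem pairwise_sortedParts {k : ℕ} (p : Nat.Partition k) :
    (sortedParts p).Pairwise (· ≥ ·) := by
  rw [sortedParts, List.pairwise_reverse]
  exact Multiset.pairwise_sort _ _

theorem length_sortedParts_le {k : ℕ} (p : Nat.Partition k) : (sortedParts p).length ≤ k := by
  rw [← Multiset.coe_card, coe_sortedParts]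
  have := Multiset.card_nsmul_le_sum (s := p.parts) (a := 1) fun i hi => p.parts_pos hi
  simpa [p.parts_sum] using this

theorem sum_partition_getD {A : Type*} [AddCommMonoid A] {k m M : ℕ} (hkm : k ≤ m + 1)
    (hkM : k ≤ M) (F : (Fin (m + 1) → ℕ) → A) :
    ∑ p : Nat.Partition k, F (fun i : Fin (m + 1) => (sortedParts p).getD i 0) =
      ∑ l ∈ partitionBox m M with ∑ i, l i = k, F l := by
  have h_ofFn (p : Nat.Partition k) := (sortedParts p).ofFn_getD_zero
    ((length_sortedParts_le p).trans hkm)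
  have h_pairwise (p : Nat.Partition k) :
      (List.ofFn fun i : Fin (m + 1) => (sortedParts p).getD i 0).Pairwise (· ≥ ·) := by
    rw [h_ofFn, List.pairwise_append]
    refine ⟨pairwise_sortedParts p, List.pairwise_replicate.2 (Or.inr le_rfl), fun a _ b hb => ?_⟩
    rw [List.eq_of_mem_replicate hb]
    exact Nat.zero_le a
  refine sum_bij (fun p _ i => (sortedParts p).getD i 0) (fun p _ => ?_) (fun p _ q _ hpq => ?_)
    (fun l hl => ?_) fun _ _ => rfl
  · have h_sum : ∑ i : Fin (m + 1), (sortedParts p).getD i 0 = k := by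
      rw [← List.sum_ofFn, h_ofFn, List.sum_append, ← Multiset.sum_coe, coe_sortedParts,
        p.parts_sum]
      simp
    refine mem_filter.2 ⟨mem_partitionBox.2 ⟨fun i => ?_,
      antitone_iff_pairwise_ofFn.2 (h_pairwise p)⟩, h_sum⟩
    refine le_trans ?_ (h_sum.le.trans hkM)
    exact single_le_sum (f := fun i : Fin (m + 1) => (sortedParts p).getD i 0)
      (fun _ _ => Nat.zero_le _) (mem_univ i)
  · have h_list := congrArg (fun f => ((List.ofFn f : List ℕ) : Multiset ℕ).filter (· ≠ 0)) hpq
    simp only [h_ofFn, ← Multiset.coe_add, Multiset.filter_add, coe_sortedParts,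
      Multiset.coe_replicate] at h_list
    have h_parts (r : Nat.Partition k) : r.parts.filter (· ≠ 0) = r.parts :=
      Multiset.filter_eq_self.2 fun _ ha => (r.parts_pos ha).ne'
    have h_rep (a : ℕ) : (Multiset.replicate a 0).filter (· ≠ 0) = 0 :=
      Multiset.filter_eq_nil.2 fun _ hb => not_not.2 (Multiset.eq_of_mem_replicate hb)
    rw [h_parts, h_parts, h_rep, h_rep, add_zero, add_zero] at h_list
    exact Nat.Partition.ext h_list
  · obtain ⟨hl, h_sum⟩ := mem_filter.1 hl
    let L : Multiset ℕ := (List.ofFn l : List ℕ)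
    let p : Nat.Partition k := Nat.Partition.ofSums k L (by
      rw [Multiset.sum_coe, List.sum_ofFn, h_sum])
    refine ⟨p, mem_univ _, List.ofFn_injective ?_⟩
    refine List.Perm.eq_of_pairwise (le := (· ≥ ·)) (fun a b _ _ h₁ h₂ => le_antisymm h₂ h₁)
      (h_pairwise p) (antitone_iff_pairwise_ofFn.1 (mem_partitionBox.1 hl).2) ?_
    have h_card := congrArg Multiset.card (Multiset.filter_add_not (· ≠ 0) L)
    have h_zeros : L.filter (fun a => ¬a ≠ 0) = Multiset.replicate (L.count 0) 0 := by
      simp only [not_not, Multiset.filter_eq']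
    rw [← Multiset.coe_eq_coe, h_ofFn, ← Multiset.coe_add, ← Multiset.coe_card, coe_sortedParts,
      Multiset.coe_replicate]
    change L.filter (· ≠ 0) + Multiset.replicate (m + 1 - (L.filter (· ≠ 0)).card) 0 = L
    conv_rhs => rw [← Multiset.filter_add_not (· ≠ 0) L, h_zeros]
    rw [Multiset.card_add, h_zeros, Multiset.card_replicate,
      show L.card = m + 1 by simp [L]] at h_card
    congr 2
    lia

theorem map_sum_schurJT {R A : Type*} [CommRing R] [Algebra ℤ R] [CommRing A] {M : ℕ}
    (φ : Polynomial R →+* A) (hφ : φ Polynomial.X ^ (M + 1) = 0) (t : ℕ → R) (n : ℕ) :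
    φ (∑ k ∈ range (M + 1), Polynomial.C (∑ p : Nat.Partition k,
        MvPolynomial.aeval (fun i : Fin n => t i) (schurJT (Fin n) ℤ (sortedParts p))) *
          Polynomial.X ^ k) =
      ∑ l ∈ partitionBox M M,
        jacobiTrudi (completeHomog (fun i => φ Polynomial.X * φ (Polynomial.C (t i))) n) l := by
  have h_pow (l : Fin (M + 1) → ℕ) :
      jacobiTrudi (completeHomog (fun i => φ Polynomial.X * φ (Polynomial.C (t i))) n) l =
        φ Polynomial.X ^ (∑ i, l i) * φ (Polynomial.C (jacobiTrudi (completeHomog t n) l)) := by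
    rw [jacobiTrudi_pow_mul _ (fun k => completeHomog_of_neg _ n) (completeHomog_mul_left _ _ n)]
    congr 1
    refine Eq.trans ?_ (map_jacobiTrudi (φ.comp Polynomial.C) (completeHomog t n) l).symm
    congr 1
    ext k
    exact (map_completeHomog (φ.comp Polynomial.C) t n k).symm
  rw [← sum_filter_add_sum_filter_not (partitionBox M M) (fun l => ∑ i, l i ∈ range (M + 1)),
    sum_eq_zero (s := {l ∈ partitionBox M M | ¬∑ i, l i ∈ range (M + 1)}) fun l hl => ?_,
    add_zero, ← sum_fiberwise_of_maps_to (t := range (M + 1))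
      (g := fun l : Fin (M + 1) → ℕ => ∑ i, l i) fun l hl => (mem_filter.1 hl).2, map_sum]
  · refine sum_congr rfl fun k hk => ?_
    have hkM : k ≤ M := Nat.lt_succ_iff.1 (mem_range.1 hk)
    rw [sum_congr rfl fun p _ => (aeval_schurJT t n (sortedParts p)).trans
      (jacobiTrudi_getD (fun k => completeHomog_of_neg t n) (completeHomog_zero t n) _
        (((length_sortedParts_le p).trans hkM).trans M.le_succ)).symm,
      sum_partition_getD (hkM.trans M.le_succ) hkM, filter_filter, map_mul, map_sum, map_sum,
      sum_mul]
    refine sum_congr ?_ fun l hl => ?_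
    · exact filter_congr fun l _ => ⟨fun h => ⟨h ▸ hk, h⟩, And.right⟩
    · rw [h_pow, show ∑ i, l i = k from (mem_filter.1 hl).2.2, map_pow, mul_comm]
  · rw [h_pow, pow_eq_zero_of_le (not_lt.1 (mt mem_range.2 (mem_filter.1 hl).2)) hφ, zero_mul]

universe u in
theorem Polynomial.coeff_eq_coeff_one_of_forall_map_eq_one {R : Type u} [CommRing R]
    {P : Polynomial R} {M : ℕ}
    (h : ∀ (A : Type u) [CommRing A] (φ : Polynomial R →+* A), φ X ^ (M + 1) = 0 → φ P = 1) :
    P.coeff M = (1 : Polynomial R).coeff M := by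
  let J : Ideal (Polynomial R) := Ideal.span {X ^ (M + 1)}
  have hJ : Ideal.Quotient.mk J X ^ (M + 1) = 0 := by
    rw [← map_pow]
    exact Ideal.Quotient.eq_zero_iff_mem.2 (Ideal.mem_span_singleton_self _)
  have h_dvd : X ^ (M + 1) ∣ P - 1 := Ideal.mem_span_singleton.1
    (Ideal.Quotient.eq.1 ((h _ (Ideal.Quotient.mk J) hJ).trans (map_one _).symm))
  exact sub_eq_zero.1 ((coeff_sub P 1 M).symm.trans (X_pow_dvd_iff.1 h_dvd M M.lt_succ_self))

/-- Littlewood's identity under the principal specialization `x_i = t^{i−1}`: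
`∑_λ s_λ(1, t, t², ...)·u^{|λ|} = ∏_{i≥1} (1 − u·t^{i−1})^{−1} · ∏_{i<j} (1 − u²·t^{i+j−2})^{−1}`
as formal power series in `u` and `t`.  Here it is stated in `n` variables (so the products
run over `1 ≤ i < j ≤ n` and the sum over partitions with at most `n` parts, Schur polynomials
of longer partitions being zero), in multiplied-through form, comparing the coefficients of
`u^M` in the ring `(ℤ[t])[u]` (the sum over partitions being truncated at `|λ| ≤ M`, since
larger partitions do not affect the coefficient of `u^M`). -/
theorem littlewood_principal_specialization (n M : ℕ) :
    Polynomial.coeff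
        ((∑ k ∈ Finset.range (M + 1),
            Polynomial.C (∑ p : Nat.Partition k,
              MvPolynomial.aeval (fun i : Fin n => (Polynomial.X : Polynomial ℤ) ^ (i : ℕ))
                (schurJT (Fin n) ℤ (sortedParts p))) * Polynomial.X ^ k) *
          (∏ i ∈ Finset.range n,
            (1 - Polynomial.C ((Polynomial.X : Polynomial ℤ) ^ i) * Polynomial.X)) *
          (∏ pr ∈ (Finset.range n ×ˢ Finset.range n).filter (fun pr : ℕ × ℕ => pr.1 < pr.2),
            (1 - Polynomial.C ((Polynomial.X : Polynomial ℤ) ^ (pr.1 + pr.2)) *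
              Polynomial.X ^ 2))) M =
      Polynomial.coeff (1 : Polynomial (Polynomial ℤ)) M := by
  refine Polynomial.coeff_eq_coeff_one_of_forall_map_eq_one fun A _ φ hφ => ?_
  rw [map_mul, map_mul, map_sum_schurJT φ hφ (fun i => Polynomial.X ^ i),
    ← littlewood_identity_of_nilpotent hφ (fun i => φ (Polynomial.C (Polynomial.X ^ i))) n,
    map_prod, map_prod]
  refine congrArg₂ (· * ·) (congrArg₂ (· * ·) rfl (prod_congr rfl fun i _ => ?_))
    (prod_congr rfl fun p _ => ?_)
  · rw [map_sub, map_one, map_mul, mul_comm]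
  · simp only [map_sub, map_one, map_mul, map_pow, pow_add]
    ring
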